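/- Let ⟨X,<⟩ be a countably infinite ultrahomogeneous partial order. Then the partial order ⟨ℙ(X), ⊆⟩ of copies of X contains a countable maximal antichain if and only if X is neither an infinite antichain (i.e., it is not the case that all distinct elements of X are incomparable) nor order-isomorphic to B_ω, where B_ω is the partial order on ℕ × ℚ defined by ⟨i,p⟩ < ⟨j,q⟩ iff i = j and p < q. -/

import Mathlib

/-- A partial order is ultrahomogeneous if every order-isomorphism between finite
subsets extends to an order-automorphism. -/
def UltrahomogeneousOrder (X : Type*) [PartialOrder X] : Prop :=
  ∀ (F G : Set X), F.Finite → G.Finite → ∀ φ : F ≃o G,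
    ∃ g : X ≃o X, ∀ x : F, g x = (φ x : X)

/-- `A` is a copy of the poset `X`: `⟨A,<⟩` is order-isomorphic to `⟨X,<⟩`. -/
def IsCopyO {X : Type*} [PartialOrder X] (A : Set X) : Prop :=
  Nonempty (A ≃o X)

/-- Two copies are compatible if some copy is contained in both. -/
def CompatO {X : Type*} [PartialOrder X] (A B : Set X) : Prop :=
  ∃ C : Set X, IsCopyO C ∧ C ⊆ A ∧ C ⊆ B

/-- A maximal antichain in the poset of copies of `X`. -/
def IsMaxAntichainO {X : Type*} [PartialOrder X] (𝒜 : Set (Set X)) : Prop :=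
  (∀ A ∈ 𝒜, IsCopyO A) ∧
  (∀ A ∈ 𝒜, ∀ B ∈ 𝒜, A ≠ B → ¬ CompatO A B) ∧
  (∀ Z : Set X, IsCopyO Z → ∃ A ∈ 𝒜, CompatO Z A)

/-- The order `B_ω` on `ℕ × ℚ`. -/
def Bw : ℕ × ℚ → ℕ × ℚ → Prop :=
  fun a b => a.1 = b.1 ∧ a.2 < b.2


namespace UHP

open Set

/-- `f` is an order embedding of `X` to itself, as a plain function. -/
def OE {X : Type*} [PartialOrder X] (f : X → X) : Prop := ∀ x y, f x ≤ f y ↔ x ≤ y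

section basics
variable {X : Type*} [PartialOrder X]

lemma OE.inj {f : X → X} (h : OE f) : Function.Injective f := fun x y e =>
  le_antisymm ((h x y).1 e.le) ((h y x).1 e.ge)

lemma OE.comp {f g : X → X} (h : OE f) (h' : OE g) : OE (f ∘ g) := fun _ _ =>
  (h _ _).trans (h' _ _)

lemma isCopy_range {f : X → X} (h : OE f) : IsCopyO (range f) :=
  ⟨(OrderEmbedding.ofMapLEIff f h).orderIso.symm⟩

lemma copy_emb {A : Set X} (h : IsCopyO A) : ∃ f : X → X, OE f ∧ range f = A := by
  obtain ⟨e⟩ := h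
  refine ⟨fun x => (e.symm x : X), fun x y => ?_, ?_⟩
  · exact (Subtype.coe_le_coe).trans (e.symm.le_iff_le)
  · ext x
    constructor
    · rintro ⟨y, rfl⟩
      exact (e.symm y).2
    · intro hx
      exact ⟨e ⟨x, hx⟩, by simp⟩

lemma compat_iff {A B : Set X} :
    CompatO A B ↔ ∃ f : X → X, OE f ∧ ∀ x, f x ∈ A ∧ f x ∈ B := by
  constructor
  · rintro ⟨C, hC, hA, hB⟩
    obtain ⟨f, hf, rfl⟩ := copy_emb hC
    exact ⟨f, hf, fun x => ⟨hA ⟨x, rfl⟩, hB ⟨x, rfl⟩⟩⟩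
  · rintro ⟨f, hf, h⟩
    refine ⟨range f, isCopy_range hf, ?_, ?_⟩
    · rintro _ ⟨x, rfl⟩; exact (h x).1
    · rintro _ ⟨x, rfl⟩; exact (h x).2

lemma mk_antichain {ι : Type*} [Countable ι] [Infinite ι] (A : ι → Set X)
    (hc : ∀ i, IsCopyO (A i)) (hd : ∀ i j, i ≠ j → ¬ CompatO (A i) (A j))
    (hm : ∀ Z, IsCopyO Z → ∃ i, CompatO Z (A i)) :
    ∃ 𝒜 : Set (Set X), 𝒜.Countable ∧ 𝒜.Infinite ∧ IsMaxAntichainO 𝒜 := by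
  refine ⟨range A, countable_range A, infinite_range_of_injective ?_, ?_, ?_, ?_⟩
  · intro i j e
    by_contra hne
    apply hd i j hne
    rw [← e]
    exact ⟨A i, hc i, subset_rfl, subset_rfl⟩
  · rintro _ ⟨i, rfl⟩; exact hc i
  · rintro _ ⟨i, rfl⟩ _ ⟨j, rfl⟩ hne
    exact hd i j (fun e => hne (by rw [e]))
  · intro Z hZ
    obtain ⟨i, hi⟩ := hm Z hZ
    exact ⟨A i, ⟨i, rfl⟩, hi⟩

end basics

section mad
variable {X : Type*} [PartialOrder X] {K R : Type*} [LinearOrder R]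

/-- the coordinates of an embedding of a disjoint union of chains -/
lemma comp_const (Φ : X ≃ K × R)
    (hΦ : ∀ x y, x ≤ y ↔ (Φ x).1 = (Φ y).1 ∧ (Φ x).2 ≤ (Φ y).2)
    {f : X → X} (hf : OE f) (x y : X) : (Φ (f x)).1 = (Φ (f y)).1 ↔ (Φ x).1 = (Φ y).1 := by
  have key : ∀ x y : X, (Φ x).1 = (Φ y).1 ↔ x ≤ y ∨ y ≤ x := by
    intro x y
    rw [hΦ, hΦ]
    constructor
    · intro h
      rcases le_total (Φ x).2 (Φ y).2 with h' | h'
      · exact Or.inl ⟨h, h'⟩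
      · exact Or.inr ⟨h.symm, h'⟩
    · rintro (h | h)
      · exact h.1
      · exact h.1.symm
  rw [key, key, hf, hf]

variable (Φ : X ≃ ℕ × R)

/-- indices of components in which `A` contains a copy of `R` -/
def rich (A : Set X) : Set ℕ :=
  {k | ∃ h : R → R, (∀ r s, h r ≤ h s ↔ r ≤ s) ∧ ∀ r, Φ.symm (k, h r) ∈ A}

lemma rich_inf
    (hΦ : ∀ x y, x ≤ y ↔ (Φ x).1 = (Φ y).1 ∧ (Φ x).2 ≤ (Φ y).2)
    [Nonempty R] {A : Set X} {f : X → X} (hf : OE f) (hA : ∀ x, f x ∈ A) :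
    (rich Φ A).Infinite := by
  obtain ⟨r0⟩ := ‹Nonempty R›
  have hinj : Function.Injective (fun k : ℕ => (Φ (f (Φ.symm (k, r0)))).1) := by
    intro k l e
    have := (comp_const Φ hΦ hf _ _).1 e
    simpa using this
  refine (infinite_range_of_injective hinj).mono ?_
  rintro _ ⟨k, rfl⟩
  refine ⟨fun r => (Φ (f (Φ.symm (k, r)))).2, fun r s => ?_, fun r => ?_⟩
  · have h1 := hΦ (f (Φ.symm (k, r))) (f (Φ.symm (k, s)))
    rw [hf, hΦ] at h1
    have h2 := (comp_const Φ hΦ hf (Φ.symm (k, r)) (Φ.symm (k, s))).2 (by simp)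
    simp only [Equiv.apply_symm_apply, true_and] at h1
    rw [h1]
    simp [h2]
  · have h2 := (comp_const Φ hΦ hf (Φ.symm (k, r)) (Φ.symm (k, r0))).2 (by simp)
    have : Φ.symm ((Φ (f (Φ.symm (k, r0)))).1, (Φ (f (Φ.symm (k, r)))).2)
        = f (Φ.symm (k, r)) := by
      rw [← h2]; simp
    simp only [this]
    exact hA _

lemma oe_of
    (hΦ : ∀ x y, x ≤ y ↔ (Φ x).1 = (Φ y).1 ∧ (Φ x).2 ≤ (Φ y).2)
    (k : ℕ → ℕ) (hk : Function.Injective k) (h : ℕ → R → R)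
    (hh : ∀ n r s, h n r ≤ h n s ↔ r ≤ s) :
    OE (fun x => Φ.symm (k (Φ x).1, h (Φ x).1 (Φ x).2)) := by
  intro x y
  rw [hΦ, hΦ]
  simp only [Equiv.apply_symm_apply, hk.eq_iff]
  constructor
  · rintro ⟨h1, h2⟩
    refine ⟨h1, ?_⟩
    rw [h1] at h2
    exact (hh _ _ _).1 h2
  · rintro ⟨h1, h2⟩
    refine ⟨h1, ?_⟩
    rw [h1]
    exact (hh _ _ _).2 h2

lemma emb_of_rich
    (hΦ : ∀ x y, x ≤ y ↔ (Φ x).1 = (Φ y).1 ∧ (Φ x).2 ≤ (Φ y).2)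
    {A : Set X} (hA : (rich Φ A).Infinite) :
    ∃ f : X → X, OE f ∧ ∀ x, f x ∈ A := by
  let e := hA.natEmbedding
  choose h h1 h2 using fun n => (e n).2
  exact ⟨_, oe_of Φ hΦ (fun n => (e n : ℕ)) (fun a b hab => e.injective (Subtype.ext hab)) h h1,
    fun x => h2 _ _⟩

theorem no_countable
    (hΦ : ∀ x y, x ≤ y ↔ (Φ x).1 = (Φ y).1 ∧ (Φ x).2 ≤ (Φ y).2)
    [Nonempty R] :
    ¬ ∃ 𝒜 : Set (Set X), 𝒜.Countable ∧ 𝒜.Infinite ∧ IsMaxAntichainO 𝒜 := by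
  rintro ⟨𝒜, hc, hi, h1, h2, h3⟩
  have : Countable 𝒜 := hc.to_subtype
  have : Infinite 𝒜 := hi.to_subtype
  obtain ⟨e⟩ : Nonempty (ℕ ≃ 𝒜) := by
    obtain ⟨d⟩ := nonempty_denumerable 𝒜
    exact ⟨(Denumerable.eqv 𝒜).symm⟩
  let A : ℕ → Set X := fun n => (e n : Set X)
  have hfin : ∀ n m, n ≠ m → (rich Φ (A n ∩ A m)).Finite := by
    intro n m hnm
    by_contra hinf
    obtain ⟨f, hf, hfA⟩ := emb_of_rich Φ hΦ hinf
    exact h2 _ (e n).2 _ (e m).2 (fun h => hnm (e.injective (Subtype.ext h)))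
      (compat_iff.2 ⟨f, hf, hfA⟩)
  have hinf : ∀ n, (rich Φ (A n) \ ⋃ m ∈ Iio n, rich Φ (A n ∩ A m)).Infinite := by
    intro n
    obtain ⟨f, hf, hr⟩ := copy_emb (h1 _ (e n).2)
    refine (rich_inf Φ hΦ (A := A n) hf (fun x => ?_)).sdiff ?_
    · have : f x ∈ range f := mem_range_self x
      rw [hr] at this
      exact this
    · exact (finite_Iio n).biUnion fun m hm => hfin n m (ne_of_gt hm)
  obtain ⟨k, hk, hkP⟩ := Filter.extraction_forall_of_frequently
    (P := fun n k => k ∈ (rich Φ (A n) \ ⋃ m ∈ Iio n, rich Φ (A n ∩ A m)))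
    (fun n => Nat.frequently_atTop_iff_infinite.2 (hinf n))
  choose h hh hA using fun n => (hkP n).1
  have hF := oe_of Φ hΦ k hk.injective h hh
  obtain ⟨B, hB, hZB⟩ := h3 _ (isCopy_range hF)
  obtain ⟨m, hm⟩ := e.surjective ⟨B, hB⟩
  have hm : A m = B := by simp [A, hm]
  subst hm
  obtain ⟨f, hf, hfZ⟩ := compat_iff.1 hZB
  refine (rich_inf Φ hΦ (A := range _ ∩ A m) hf hfZ) (((finite_Iic m).image k).subset ?_)
  rintro κ ⟨g, hg, hgZ⟩
  have hκ : ∀ r, ∃ n, κ = k n ∧ Φ.symm (κ, g r) ∈ A n := by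
    intro r
    obtain ⟨y, hy⟩ := (hgZ r).1
    have hy' := Φ.symm.injective hy
    refine ⟨(Φ y).1, ((Prod.ext_iff.1 hy').1).symm, ?_⟩
    rw [← hy]
    exact hA _ _
  obtain ⟨r0⟩ := ‹Nonempty R›
  obtain ⟨n, hn, -⟩ := hκ r0
  by_cases hnm : n ≤ m
  · exact ⟨n, hnm, hn.symm⟩
  exfalso
  apply (hkP n).2
  simp only [mem_iUnion]
  refine ⟨m, not_le.1 hnm, g, hg, fun r => ?_⟩
  rw [← hn]
  refine ⟨?_, (hgZ r).2⟩
  obtain ⟨n', hn', h'⟩ := hκ r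
  have : n' = n := hk.injective (hn'.symm.trans hn)
  rwa [this] at h'

end mad

section rat

lemma ioo_emb (a b : ℚ) (hab : a < b) :
    ∃ h : ℚ → ℚ, (∀ r s, h r ≤ h s ↔ r ≤ s) ∧ range h = Ioo a b := by
  have : Nonempty (Ioo a b) := nonempty_Ioo_subtype hab
  obtain ⟨e⟩ := Order.iso_of_countable_dense ℚ (Ioo a b)
  refine ⟨fun q => (e q : ℚ), fun r s => (Subtype.coe_le_coe).trans e.le_iff_le, ?_⟩
  ext x
  constructor
  · rintro ⟨y, rfl⟩
    exact (e y).2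
  · intro hx
    exact ⟨e.symm ⟨x, hx⟩, by simp⟩

lemma exists_piece (g : ℚ → ℚ) (hg : StrictMono g) :
    ∃ (i : ℤ) (h : ℚ → ℚ), (∀ r s, h r ≤ h s ↔ r ≤ s) ∧ ∀ r, g (h r) ∈ Ioo (i : ℚ) (i + 1) := by
  have hmono : ∀ a b : ℚ, a < b → ⌊g a⌋ ≤ ⌊g b⌋ := fun a b h => Int.floor_mono (hg h).le
  have hP : ∃ m : ℕ, ∃ a b : ℚ, a < b ∧ (⌊g b⌋ - ⌊g a⌋).toNat = m := ⟨_, 0, 1, by norm_num, rfl⟩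
  classical
  obtain ⟨a, b, hab, hm⟩ := Nat.find_spec hP
  obtain ⟨c, hac, hcb⟩ := exists_between hab
  have h1 := Nat.find_min' hP ⟨a, c, hac, rfl⟩
  have h2 := Nat.find_min' hP ⟨c, b, hcb, rfl⟩
  have h3 := hmono a c hac
  have h4 := hmono c b hcb
  have h5 : ⌊g b⌋ = ⌊g a⌋ := by omega
  obtain ⟨h, hh, hr⟩ := ioo_emb a b hab
  refine ⟨⌊g a⌋, h, hh, fun r => ?_⟩
  have hr' : h r ∈ Ioo a b := hr ▸ mem_range_self r
  constructor
  · exact (Int.floor_le _).trans_lt (hg hr'.1)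
  · rw [← h5]
    exact (hg hr'.2).trans (Int.lt_floor_add_one _)

lemma ioo_disj {i j : ℤ} {q : ℚ} (h1 : q ∈ Ioo (i : ℚ) (i + 1)) (h2 : q ∈ Ioo (j : ℚ) (j + 1)) :
    i = j := by
  have h3 : (i : ℚ) < j + 1 := h1.1.trans h2.2
  have h4 : (j : ℚ) < i + 1 := h2.1.trans h1.2
  norm_cast at h3 h4
  omega

end rat

section caseB
variable {X : Type*} [PartialOrder X] {K : Type*}

theorem caseB [Finite K] [Nonempty K] (Φ : X ≃ K × ℚ)
    (hΦ : ∀ x y, x ≤ y ↔ (Φ x).1 = (Φ y).1 ∧ (Φ x).2 ≤ (Φ y).2) :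
    ∃ 𝒜 : Set (Set X), 𝒜.Countable ∧ 𝒜.Infinite ∧ IsMaxAntichainO 𝒜 := by
  classical
  obtain ⟨k0⟩ := ‹Nonempty K›
  have oe : ∀ h : K → ℚ → ℚ, (∀ k r s, h k r ≤ h k s ↔ r ≤ s) →
      OE (fun x => Φ.symm ((Φ x).1, h (Φ x).1 (Φ x).2)) := by
    intro h hh x y
    rw [hΦ, hΦ]
    simp only [Equiv.apply_symm_apply]
    constructor
    · rintro ⟨h1, h2⟩
      rw [h1] at h2
      exact ⟨h1, (hh _ _ _).1 h2⟩
    · rintro ⟨h1, h2⟩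
      rw [h1]
      exact ⟨rfl, (hh _ _ _).2 h2⟩
  have hsur : ∀ f : X → X, OE f → ∃ k1, ∀ q, (Φ (f (Φ.symm (k1, q)))).1 = k0 := by
    intro f hf
    have hinj : Function.Injective (fun k : K => (Φ (f (Φ.symm (k, 0)))).1) := by
      intro k l e
      have := (comp_const Φ hΦ hf _ _).1 e
      simpa using this
    obtain ⟨k1, hk1⟩ := (Finite.injective_iff_surjective.1 hinj) k0
    refine ⟨k1, fun q => ?_⟩
    rw [← hk1]
    exact (comp_const Φ hΦ hf _ _).2 (by simp)
  refine mk_antichain (ι := ℤ)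
    (fun i => {x | (Φ x).1 = k0 → (Φ x).2 ∈ Ioo (i : ℚ) (i + 1)}) ?_ ?_ ?_
  · intro i
    obtain ⟨h, hh, hr⟩ := ioo_emb (i : ℚ) (i + 1) (by linarith)
    have := oe (fun k => if k = k0 then h else id) (by
      intro k r s
      by_cases hk : k = k0 <;> simp [hk, hh])
    convert isCopy_range this using 1
    ext x
    simp only [mem_ofPred_eq, mem_range]
    constructor
    · intro hx
      by_cases hk : (Φ x).1 = k0
      · have := hx hk
        rw [← hr] at this
        obtain ⟨q, hq⟩ := this
        refine ⟨Φ.symm (k0, q), ?_⟩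
        simp only [Equiv.apply_symm_apply, if_true, hq]
        rw [← hk]; simp
      · exact ⟨x, by simp [hk]⟩
    · rintro ⟨y, rfl⟩ hk
      simp only [Equiv.apply_symm_apply] at hk ⊢
      rw [if_pos hk, ← hr]
      exact mem_range_self _
  · intro i j hij hc
    obtain ⟨f, hf, hfA⟩ := compat_iff.1 hc
    obtain ⟨k1, hk1⟩ := hsur f hf
    have := hfA (Φ.symm (k1, 0))
    exact hij (ioo_disj (this.1 (hk1 0)) (this.2 (hk1 0)))
  · intro Z hZ
    obtain ⟨f, hf, rfl⟩ := copy_emb hZ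
    obtain ⟨k1, hk1⟩ := hsur f hf
    have hmono : StrictMono (fun q => (Φ (f (Φ.symm (k1, q)))).2) := by
      apply strictMono_of_le_iff_le
      intro r s
      have := hf (Φ.symm (k1, r)) (Φ.symm (k1, s))
      rw [hΦ, hΦ, hk1, hk1] at this
      simpa using this.symm
    obtain ⟨i, h, hh, hi⟩ := exists_piece _ hmono
    refine ⟨i, compat_iff.2 ⟨_, hf.comp (oe (fun k => if k = k1 then h else id) (by
      intro k r s
      by_cases hk : k = k1 <;> simp [hk, hh])), fun x => ⟨mem_range_self _, ?_⟩⟩⟩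
    intro hx
    simp only [Function.comp] at hx ⊢
    have hxk : (Φ x).1 = k1 := by
      rw [← hk1 0] at hx
      have := (comp_const Φ hΦ hf _ _).1 hx
      simpa using this
    rw [if_pos hxk, hxk]
    exact hi _

theorem caseC [Nonempty K] (Φ : X ≃ ℚ × K) (hΦ : ∀ x y, x < y ↔ (Φ x).1 < (Φ y).1) :
    ∃ 𝒜 : Set (Set X), 𝒜.Countable ∧ 𝒜.Infinite ∧ IsMaxAntichainO 𝒜 := by
  obtain ⟨k0⟩ := ‹Nonempty K›
  have oe : ∀ h : ℚ → ℚ, (∀ r s, h r ≤ h s ↔ r ≤ s) →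
      OE (fun x => Φ.symm (h (Φ x).1, (Φ x).2)) := by
    intro h hh x y
    have hs : StrictMono h := strictMono_of_le_iff_le (fun r s => (hh r s).symm)
    rw [le_iff_lt_or_eq, le_iff_lt_or_eq, hΦ, hΦ]
    simp only [Equiv.apply_symm_apply, hs.lt_iff_lt, Φ.symm.injective.eq_iff, Prod.ext_iff,
      hs.injective.eq_iff, ← Φ.injective.eq_iff (a := x)]
  refine mk_antichain (ι := ℤ) (fun i => {x | (Φ x).1 ∈ Ioo (i : ℚ) (i + 1)}) ?_ ?_ ?_
  · intro i
    obtain ⟨h, hh, hr⟩ := ioo_emb (i : ℚ) (i + 1) (by linarith)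
    convert isCopy_range (oe h hh) using 1
    ext x
    simp only [mem_ofPred_eq, mem_range]
    rw [← hr]
    constructor
    · rintro ⟨q, hq⟩
      exact ⟨Φ.symm (q, (Φ x).2), by simp [hq]⟩
    · rintro ⟨y, rfl⟩
      simp
  · intro i j hij hc
    obtain ⟨f, hf, hfA⟩ := compat_iff.1 hc
    have := hfA (Φ.symm (0, k0))
    exact hij (ioo_disj this.1 this.2)
  · intro Z hZ
    obtain ⟨f, hf, rfl⟩ := copy_emb hZ
    have hlt : ∀ x y, f x < f y ↔ x < y := fun x y => by
      rw [lt_iff_le_not_ge, lt_iff_le_not_ge, hf, hf]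
    have hfst : ∀ x y : X, (Φ (f x)).1 < (Φ (f y)).1 ↔ (Φ x).1 < (Φ y).1 := fun x y => by
      rw [← hΦ, ← hΦ, hlt]
    have hmono : StrictMono (fun q => (Φ (f (Φ.symm (q, k0)))).1) := by
      intro r s hrs
      exact (hfst _ _).2 (by simpa using hrs)
    obtain ⟨i, h, hh, hi⟩ := exists_piece _ hmono
    refine ⟨i, compat_iff.2 ⟨_, hf.comp (oe h hh), fun x => ⟨mem_range_self _, ?_⟩⟩⟩
    have heq : (Φ (f (Φ.symm (h (Φ x).1, (Φ x).2)))).1 = (Φ (f (Φ.symm (h (Φ x).1, k0)))).1 := by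
      apply le_antisymm <;>
      · rw [← not_lt, hfst]; simp
    simp only [Function.comp, mem_ofPred_eq]
    rw [heq]
    exact hi _

end caseB

section hom

/-- Ultrahomogeneity in terms of finite families. -/
def Hom (X : Type) [PartialOrder X] : Prop :=
  ∀ (ι : Type) [Finite ι] (a b : ι → X), (∀ i j, a i ≤ a j ↔ b i ≤ b j) →
    ∃ g : X ≃o X, ∀ i, g (a i) = b i

/-- Incomparability. -/
def Inc {X : Type} [PartialOrder X] (a b : X) : Prop := ¬ a ≤ b ∧ ¬ b ≤ a

variable {X : Type} [PartialOrder X]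

lemma hom_of_uh (h : UltrahomogeneousOrder X) : Hom X := by
  intro ι _ a b hab
  have eq1 : ∀ i j, a i = a j → b i = b j := fun i j e =>
    le_antisymm ((hab _ _).1 e.le) ((hab _ _).1 e.ge)
  have eq2 : ∀ i j, b i = b j → a i = a j := fun i j e =>
    le_antisymm ((hab _ _).2 e.le) ((hab _ _).2 e.ge)
  let φ : range a ≃o range b :=
    { toFun := fun x => ⟨b x.2.choose, mem_range_self _⟩
      invFun := fun y => ⟨a y.2.choose, mem_range_self _⟩
      left_inv := by
        intro x
        apply Subtype.ext
        have hx := x.2.choose_spec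
        have hy := (mem_range_self (f := b) x.2.choose).choose_spec
        exact (eq2 _ _ hy).trans hx
      right_inv := by
        intro x
        apply Subtype.ext
        have hx := x.2.choose_spec
        have hy := (mem_range_self (f := a) x.2.choose).choose_spec
        exact (eq1 _ _ hy).trans hx
      map_rel_iff' := by
        intro x y
        have hx := x.2.choose_spec
        have hy := y.2.choose_spec
        change b x.2.choose ≤ b y.2.choose ↔ (x : X) ≤ y
        rw [← hab, hx, hy] }
  obtain ⟨g, hg⟩ := h (range a) (range b) (finite_range a) (finite_range b) φ
  refine ⟨g, fun i => ?_⟩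
  have := hg ⟨a i, mem_range_self i⟩
  rw [this]
  exact eq1 _ _ (mem_range_self (f := a) i).choose_spec

lemma Hom.dual (h : Hom X) : Hom Xᵒᵈ := by
  intro ι _ a b hab
  obtain ⟨g, hg⟩ := h ι (fun i => OrderDual.ofDual (a i)) (fun i => OrderDual.ofDual (b i))
    (fun i j => hab j i)
  exact ⟨g.dual, fun i => congrArg OrderDual.toDual (hg i)⟩

lemma Hom.one (h : Hom X) (x y : X) : ∃ g : X ≃o X, g x = y := by
  obtain ⟨g, hg⟩ := h Unit (fun _ => x) (fun _ => y) (by simp)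
  exact ⟨g, hg ()⟩

lemma Hom.lt (h : Hom X) {a b c d : X} (hab : a < b) (hcd : c < d) :
    ∃ g : X ≃o X, g a = c ∧ g b = d := by
  obtain ⟨g, hg⟩ := h (Fin 2) ![a, b] ![c, d] (by
    simp [Fin.forall_fin_succ, hab.le, hcd.le, hab.not_ge, hcd.not_ge])
  exact ⟨g, hg 0, hg 1⟩

lemma Hom.inc (h : Hom X) {a b c d : X} (hab : Inc a b) (hcd : Inc c d) :
    ∃ g : X ≃o X, g a = c ∧ g b = d := by
  obtain ⟨g, hg⟩ := h (Fin 2) ![a, b] ![c, d] (by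
    simp [Fin.forall_fin_succ, hab.1, hcd.1, hab.2, hcd.2])
  exact ⟨g, hg 0, hg 1⟩

lemma above (h : Hom X) (hlt : ∃ x y : X, x < y) (x : X) : ∃ y, x < y := by
  obtain ⟨a, b, hab⟩ := hlt
  obtain ⟨g, hg⟩ := h.one a x
  exact ⟨g b, hg ▸ g.lt_iff_lt.2 hab⟩

lemma below (h : Hom X) (hlt : ∃ x y : X, x < y) (x : X) : ∃ y, y < x := by
  obtain ⟨a, b, hab⟩ := hlt
  obtain ⟨g, hg⟩ := h.one b x
  exact ⟨g a, hg ▸ g.lt_iff_lt.2 hab⟩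

lemma between (h : Hom X) (hlt : ∃ x y : X, x < y) {x y : X} (hxy : x < y) :
    ∃ z, x < z ∧ z < y := by
  obtain ⟨z, hz⟩ := above h hlt y
  obtain ⟨g, hg1, hg2⟩ := h.lt (hxy.trans hz) hxy
  have h1 := g.lt_iff_lt.2 hxy
  have h2 := g.lt_iff_lt.2 hz
  rw [hg1] at h1
  rw [hg2] at h2
  exact ⟨g y, h1, h2⟩

/-- A chain in a poset, dense and without end points in itself, is a copy of `ℚ`. -/
lemma chain_iso [Countable X] (T : Set X) (hne : T.Nonempty)
    (htot : ∀ x ∈ T, ∀ y ∈ T, x ≤ y ∨ y ≤ x)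
    (hab : ∀ x ∈ T, ∃ y ∈ T, x < y) (hbe : ∀ x ∈ T, ∃ y ∈ T, y < x)
    (hbt : ∀ x ∈ T, ∀ y ∈ T, x < y → ∃ z ∈ T, x < z ∧ z < y) : Nonempty (T ≃o ℚ) := by
  classical
  let : LinearOrder T :=
    { (inferInstance : PartialOrder T) with
      le_total := fun x y => htot x x.2 y y.2
      toDecidableLE := Classical.decRel _ }
  have : Nonempty T := hne.to_subtype
  have : NoMaxOrder T := ⟨fun x => by
    obtain ⟨y, hy, h⟩ := hab x x.2
    exact ⟨⟨y, hy⟩, h⟩⟩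
  have : NoMinOrder T := ⟨fun x => by
    obtain ⟨y, hy, h⟩ := hbe x x.2
    exact ⟨⟨y, hy⟩, h⟩⟩
  have : DenselyOrdered T := ⟨fun x y hxy => by
    obtain ⟨z, hz, h⟩ := hbt x x.2 y y.2 hxy
    exact ⟨⟨z, hz⟩, h⟩⟩
  exact Order.iso_of_countable_dense T ℚ

theorem structC [Countable X] (h : Hom X) (hlt : ∃ x y : X, x < y)
    (no12 : ∀ a b c : X, a < b → Inc c a → Inc c b → False) :
    ∃ 𝒜 : Set (Set X), 𝒜.Countable ∧ 𝒜.Infinite ∧ IsMaxAntichainO 𝒜 := by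
  classical
  have tr : ∀ x y z : X, (¬ x < y ∧ ¬ y < x) → (¬ y < z ∧ ¬ z < y) → ¬ x < z := by
    intro x y z h1 h2 hxz
    have h3 : y ≠ x := by rintro rfl; exact h2.1 hxz
    have h4 : y ≠ z := by rintro rfl; exact h1.1 hxz
    refine no12 x z y hxz ⟨?_, ?_⟩ ⟨?_, ?_⟩ <;> intro hle
    · exact h1.2 (lt_of_le_of_ne hle h3)
    · exact h1.1 (lt_of_le_of_ne hle h3.symm)
    · exact h2.1 (lt_of_le_of_ne hle h4)
    · exact h2.2 (lt_of_le_of_ne hle h4.symm)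
  let s : Setoid X :=
    { r := fun x y => ¬ x < y ∧ ¬ y < x
      iseqv :=
        { refl := fun x => ⟨lt_irrefl x, lt_irrefl x⟩
          symm := fun h => ⟨h.2, h.1⟩
          trans := fun {x y z} h1 h2 => ⟨tr x y z h1 h2, tr z y x ⟨h2.2, h2.1⟩ ⟨h1.2, h1.1⟩⟩ } }
  have hs : ∀ x y : X, s.r x y ↔ ¬ x < y ∧ ¬ y < x := fun x y => Iff.rfl
  have lt1 : ∀ x x' y : X, x < y → s.r x x' → x' < y := by
    intro x x' y hxy hr
    by_contra hn
    have : s.r x' y := ⟨hn, fun hy => hr.1 (hxy.trans hy)⟩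
    exact (s.iseqv.trans hr this).1 hxy
  have lt2 : ∀ x y y' : X, x < y → s.r y y' → x < y' := by
    intro x y y' hxy hr
    by_contra hn
    have : s.r x y' := ⟨hn, fun hy => hr.2 (hy.trans hxy)⟩
    exact (s.iseqv.trans this (s.iseqv.symm hr)).1 hxy
  let rep : X → X := fun x => (Quotient.mk s x).out
  have rep_r : ∀ x, s.r (rep x) x := fun x => Quotient.exact (Quotient.out_eq (Quotient.mk s x))
  have rep_eq : ∀ x y, s.r x y → rep x = rep y := fun x y hxy =>
    congrArg Quotient.out (Quotient.sound hxy : Quotient.mk s x = Quotient.mk s y)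
  have rep_lt : ∀ x y, rep x < rep y ↔ x < y := fun x y =>
    ⟨fun hh => lt2 _ _ _ (lt1 _ _ _ hh (rep_r x)) (rep_r y),
     fun hh => lt2 _ _ _ (lt1 _ _ _ hh (s.iseqv.symm (rep_r x))) (s.iseqv.symm (rep_r y))⟩
  obtain ⟨x0, y0, hxy0⟩ := id hlt
  obtain ⟨e⟩ := chain_iso (range rep) ⟨_, mem_range_self x0⟩ (by
      rintro _ ⟨x, rfl⟩ _ ⟨y, rfl⟩
      by_cases h1 : x < y
      · exact Or.inl ((rep_lt _ _).2 h1).le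
      by_cases h2 : y < x
      · exact Or.inr ((rep_lt _ _).2 h2).le
      exact Or.inl (rep_eq x y ⟨h1, h2⟩).le) (by
      rintro _ ⟨x, rfl⟩
      obtain ⟨y, hy⟩ := above h hlt x
      exact ⟨_, mem_range_self y, (rep_lt _ _).2 hy⟩) (by
      rintro _ ⟨x, rfl⟩
      obtain ⟨y, hy⟩ := below h hlt x
      exact ⟨_, mem_range_self y, (rep_lt _ _).2 hy⟩) (by
      rintro _ ⟨x, rfl⟩ _ ⟨y, rfl⟩ hxy
      obtain ⟨z, hz⟩ := between h hlt ((rep_lt _ _).1 hxy)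
      exact ⟨_, mem_range_self z, (rep_lt _ _).2 hz.1, (rep_lt _ _).2 hz.2⟩)
  choose g hg using fun x : X => h.one x x0
  have g_r : ∀ (g : X ≃o X) x y, s.r (g x) (g y) ↔ s.r x y := fun g x y => by
    rw [hs, hs, g.lt_iff_lt, g.lt_iff_lt]
  let K := {k : X // s.r k x0}
  have : Nonempty K := ⟨⟨x0, s.iseqv.refl x0⟩⟩
  let F : X → ℚ × K := fun x => (e ⟨rep x, mem_range_self x⟩, ⟨g (rep x) x, by
    have := (g_r (g (rep x)) x (rep x)).2 (s.iseqv.symm (rep_r x))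
    rwa [hg] at this⟩)
  have hF : Function.Bijective F := by
    constructor
    · intro x y hxy
      have h1 := congrArg Prod.fst hxy
      have h2 := congrArg Prod.snd hxy
      have h3 : rep x = rep y := congrArg Subtype.val (e.injective h1)
      have h4 : g (rep x) x = g (rep y) y := congrArg Subtype.val h2
      rw [h3] at h4
      exact (g (rep y)).injective h4
    · rintro ⟨q, k, hk⟩
      obtain ⟨t', ht'⟩ := (e.symm q).2
      let t : X := rep t'
      let x := (g t).symm k
      have hx : s.r x t := by
        rw [← g_r (g t), hg]
        simpa [x] using hk
      have hrx : rep x = t := by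
        rw [rep_eq _ _ hx]
        exact rep_eq _ _ (rep_r t')
      refine ⟨x, ?_⟩
      apply Prod.ext
      · change e _ = q
        rw [← e.apply_symm_apply q]
        congr 1
        exact Subtype.ext (hrx.trans ht')
      · apply Subtype.ext
        change g (rep x) x = k
        rw [hrx]
        simp [x]
  refine caseC (Equiv.ofBijective F hF) (fun x y => ?_)
  change x < y ↔ e _ < e _
  rw [e.lt_iff_lt, ← rep_lt]
  exact Iff.rfl

theorem structB [Countable X] (h : Hom X) (hlt : ∃ x y : X, x < y)
    (noV : ∀ a b c : X, a < b → a < c → ¬ Inc b c)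
    (noL : ∀ a b c : X, b < a → c < a → ¬ Inc b c)
    (hB : ¬ Nonempty (((· < ·) : X → X → Prop) ≃r Bw)) :
    ∃ 𝒜 : Set (Set X), 𝒜.Countable ∧ 𝒜.Infinite ∧ IsMaxAntichainO 𝒜 := by
  classical
  let s : Setoid X :=
    { r := fun x y => x ≤ y ∨ y ≤ x
      iseqv :=
        { refl := fun x => Or.inl le_rfl
          symm := fun h => h.symm
          trans := by
            intro x y z h1 h2
            by_contra hn
            rw [not_or] at hn
            rcases h1 with h1 | h1 <;> rcases h2 with h2 | h2
            · exact hn.1 (h1.trans h2)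
            · rcases h1.eq_or_lt with rfl | h1
              · exact hn.2 h2
              rcases h2.eq_or_lt with rfl | h2
              · exact hn.1 h1.le
              exact noL _ _ _ h1 h2 hn
            · rcases h1.eq_or_lt with rfl | h1
              · exact hn.1 h2
              rcases h2.eq_or_lt with rfl | h2
              · exact hn.2 h1.le
              exact noV _ _ _ h1 h2 hn
            · exact hn.2 (h2.trans h1) } }
  have mk_eq : ∀ x y : X, Quotient.mk s x = Quotient.mk s y ↔ x ≤ y ∨ y ≤ x := fun x y =>
    ⟨fun hh => Quotient.exact hh, fun hh => Quotient.sound hh⟩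
  have hiso : ∀ k : Quotient s, Nonempty ({x : X | Quotient.mk s x = k} ≃o ℚ) := by
    intro k
    apply chain_iso
    · exact ⟨k.out, Quotient.out_eq k⟩
    · rintro x hx y hy
      exact (mk_eq x y).1 (Eq.trans hx (Eq.symm hy))
    · intro x hx
      obtain ⟨y, hy⟩ := above h hlt x
      exact ⟨y, ((mk_eq y x).2 (Or.inr hy.le)).trans hx, hy⟩
    · intro x hx
      obtain ⟨y, hy⟩ := below h hlt x
      exact ⟨y, ((mk_eq y x).2 (Or.inl hy.le)).trans hx, hy⟩
    · intro x hx y hy hxy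
      obtain ⟨z, hz⟩ := between h hlt hxy
      exact ⟨z, ((mk_eq z x).2 (Or.inr hz.1.le)).trans hx, hz⟩
  let e := fun k => (hiso k).some
  let F : X → Quotient s × ℚ := fun x => (Quotient.mk s x, e (Quotient.mk s x) ⟨x, rfl⟩)
  have key : ∀ x k (hx : Quotient.mk s x = k), (F x).2 = e k ⟨x, hx⟩ := by
    rintro x _ rfl; rfl
  have hle : ∀ x y, x ≤ y ↔ (F x).1 = (F y).1 ∧ (F x).2 ≤ (F y).2 := by
    intro x y
    constructor
    · intro hxy
      have h1 : Quotient.mk s x = Quotient.mk s y := (mk_eq x y).2 (Or.inl hxy)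
      refine ⟨h1, ?_⟩
      rw [key x _ h1, key y _ rfl, (e _).le_iff_le]
      exact hxy
    · rintro ⟨h1, h2⟩
      rw [key x _ h1, key y _ rfl, (e _).le_iff_le] at h2
      exact h2
  have hF : Function.Bijective F := by
    constructor
    · intro x y hxy
      exact le_antisymm ((hle x y).2 ⟨by rw [hxy], by rw [hxy]⟩)
        ((hle y x).2 ⟨by rw [hxy], by rw [hxy]⟩)
    · rintro ⟨k, q⟩
      refine ⟨((e k).symm q : X), ?_⟩
      have hk : Quotient.mk s ((e k).symm q : X) = k := ((e k).symm q).2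
      refine Prod.ext hk ?_
      rw [key _ _ hk]
      simp
  let Φ := Equiv.ofBijective F hF
  have : Nonempty (Quotient s) := ⟨Quotient.mk s hlt.choose⟩
  rcases finite_or_infinite (Quotient s) with hfin | hinf
  · exact caseB Φ hle
  · exfalso
    apply hB
    have : Countable (Quotient s) := inferInstance
    obtain ⟨d⟩ := nonempty_denumerable (Quotient s)
    let d' : Quotient s ≃ ℕ := Denumerable.eqv _
    refine ⟨⟨Φ.trans (d'.prodCongr (Equiv.refl ℚ)), ?_⟩⟩
    intro x y
    rw [lt_iff_le_not_ge, hle, hle]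
    change d' (F x).1 = d' (F y).1 ∧ (F x).2 < (F y).2 ↔ _
    rw [d'.injective.eq_iff]
    constructor
    · rintro ⟨h1, h2⟩
      exact ⟨⟨h1, h2.le⟩, fun h3 => h2.not_ge h3.2⟩
    · rintro ⟨h1, h2⟩
      exact ⟨h1.1, lt_of_not_ge fun h3 => h2 ⟨h1.1.symm, h3⟩⟩

end hom

section generic
variable {X : Type} [PartialOrder X]

lemma V_of_L (h : Hom X) (h12 : ∃ a b c : X, a < b ∧ Inc c a ∧ Inc c b)
    (hL : ∃ a b c : X, a < c ∧ b < c ∧ Inc a b) : ∃ a b c : X, c < a ∧ c < b ∧ Inc a b := by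
  by_contra noV
  push Not at noV
  obtain ⟨a, b, c, hac, hbc, hab⟩ := hL
  obtain ⟨p, q, r, hpq, hrp, -⟩ := h12
  obtain ⟨g, hg⟩ := h.one p c
  have hd : Inc (g r) c := by
    rw [← hg]
    exact ⟨fun hh => hrp.1 (g.le_iff_le.1 hh), fun hh => hrp.2 (g.le_iff_le.1 hh)⟩
  generalize g r = d at hd
  have key : ∀ a, a < c → Inc a d := by
    intro a hac
    constructor
    · intro had
      rcases had.eq_or_lt with rfl | had
      · exact hd.1 hac.le
      · exact noV _ _ _ had hac hd
    · intro hda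
      exact hd.1 (hda.trans hac.le)
  have had := key a hac
  have hbd := key b hbc
  obtain ⟨k, hk⟩ := h (Fin 3) ![a, b, d] ![d, b, a] (by
    simp [Fin.forall_fin_succ, hab.1, hab.2, had.1, had.2, hbd.1, hbd.2])
  have hka : k a = d := hk 0
  have hkb : k b = b := hk 1
  have hkd : k d = a := hk 2
  have h1 : d < k c := hka ▸ k.lt_iff_lt.2 hac
  have h2 : b < k c := by
    have := k.lt_iff_lt.2 hbc
    rwa [hkb] at this
  have h3 : ¬ a ≤ k c := by
    intro hh
    rw [← hkd] at hh
    exact hd.1 (k.le_iff_le.1 hh)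
  apply noV _ _ _ hbc h2
  exact ⟨fun hh => h3 (hac.le.trans hh), fun hh => hd.1 (h1.le.trans hh)⟩

/-- the two-point extension facts we need in the generic case -/
structure Gen (X : Type) [PartialOrder X] : Prop where
  hom : Hom X
  lt : ∃ x y : X, x < y
  ub : ∀ a b : X, Inc a b → ∃ u, a < u ∧ b < u
  lb : ∀ a b : X, Inc a b → ∃ u, u < a ∧ u < b
  iso : ∀ a b : X, a < b → ∃ c, Inc c a ∧ Inc c b

lemma gen_of (h : Hom X) (h12 : ∃ a b c : X, a < b ∧ Inc c a ∧ Inc c b)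
    (hL : ∃ a b c : X, a < c ∧ b < c ∧ Inc a b) (hV : ∃ a b c : X, c < a ∧ c < b ∧ Inc a b) :
    Gen X := by
  refine ⟨h, ?_, ?_, ?_, ?_⟩
  · obtain ⟨a, b, c, hab, -⟩ := h12
    exact ⟨a, b, hab⟩
  · intro x y hxy
    obtain ⟨a, b, c, hac, hbc, hab⟩ := hL
    obtain ⟨g, rfl, rfl⟩ := h.inc hab hxy
    exact ⟨g c, g.lt_iff_lt.2 hac, g.lt_iff_lt.2 hbc⟩
  · intro x y hxy
    obtain ⟨a, b, c, hac, hbc, hab⟩ := hV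
    obtain ⟨g, rfl, rfl⟩ := h.inc hab hxy
    exact ⟨g c, g.lt_iff_lt.2 hac, g.lt_iff_lt.2 hbc⟩
  · intro x y hxy
    obtain ⟨a, b, c, hab, hca, hcb⟩ := h12
    obtain ⟨g, rfl, rfl⟩ := h.lt hab hxy
    refine ⟨g c, ?_⟩
    simpa [Inc] using ⟨hca, hcb⟩

lemma gen_of' (h : Hom X) (h12 : ∃ a b c : X, a < b ∧ Inc c a ∧ Inc c b)
    (hVL : (∃ a b c : X, a < c ∧ b < c ∧ Inc a b) ∨ (∃ a b c : X, c < a ∧ c < b ∧ Inc a b)) :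
    Gen X := by
  rcases hVL with hL | hV
  · exact gen_of h h12 hL (V_of_L h h12 hL)
  · refine gen_of h h12 ?_ hV
    obtain ⟨a, b, c, h1, h2, h3⟩ := V_of_L (X := Xᵒᵈ) h.dual (by
      obtain ⟨a, b, c, h1, h2, h3⟩ := h12
      exact ⟨b, a, c, h1, ⟨h3.2, h3.1⟩, ⟨h2.2, h2.1⟩⟩) (by
      obtain ⟨a, b, c, h1, h2, h3⟩ := hV
      exact ⟨a, b, c, h1, h2, ⟨h3.2, h3.1⟩⟩)
    exact ⟨a, b, c, h1, h2, ⟨h3.2, h3.1⟩⟩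

lemma Gen.upper (h : Gen X) (F : Finset X) : ∃ M, ∀ x ∈ F, x < M := by
  classical
  induction F using Finset.induction_on with
  | empty => exact ⟨h.lt.choose, by simp⟩
  | insert a F _ ih =>
    obtain ⟨M, hM⟩ := ih
    obtain ⟨M', h1, h2⟩ : ∃ M', M ≤ M' ∧ a < M' := by
      by_cases h1 : a ≤ M
      · obtain ⟨y, hy⟩ := above h.hom h.lt M
        exact ⟨y, hy.le, h1.trans_lt hy⟩
      by_cases h2 : M ≤ a
      · obtain ⟨y, hy⟩ := above h.hom h.lt a
        exact ⟨y, h2.trans hy.le, hy⟩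
      obtain ⟨y, hy⟩ := h.ub a M ⟨h1, h2⟩
      exact ⟨y, hy.2.le, hy.1⟩
    refine ⟨M', fun x hx => ?_⟩
    rcases Finset.mem_insert.1 hx with rfl | hx
    · exact h2
    · exact (hM x hx).trans_le h1

lemma Gen.dual (h : Gen X) : Gen Xᵒᵈ := by
  refine ⟨h.hom.dual, ?_, fun a b hab => ?_, fun a b hab => ?_, fun a b hab => ?_⟩
  · obtain ⟨x, y, hxy⟩ := h.lt
    exact ⟨y, x, hxy⟩
  · exact h.lb a b ⟨hab.2, hab.1⟩
  · exact h.ub a b ⟨hab.2, hab.1⟩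
  · obtain ⟨c, h1, h2⟩ := h.iso b a hab
    exact ⟨c, ⟨h2.2, h2.1⟩, ⟨h1.2, h1.1⟩⟩

lemma Gen.lower (h : Gen X) (F : Finset X) : ∃ M, ∀ x ∈ F, M < x :=
  Gen.upper h.dual F

lemma Gen.isolated (h : Gen X) (F : Finset X) : ∃ y, ∀ x ∈ F, Inc y x := by
  classical
  obtain ⟨M, hM⟩ := h.upper (insert h.lt.choose F)
  obtain ⟨m, hm⟩ := h.lower (insert h.lt.choose F)
  obtain ⟨c, h1, h2⟩ := h.iso m M
    ((hm _ (Finset.mem_insert_self _ _)).trans (hM _ (Finset.mem_insert_self _ _)))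
  refine ⟨c, fun x hx => ⟨fun hh => ?_, fun hh => ?_⟩⟩
  · exact h2.1 (hh.trans (hM x (Finset.mem_insert_of_mem hx)).le)
  · exact h1.2 ((hm x (Finset.mem_insert_of_mem hx)).le.trans hh)

/-- number of non-minimal members of a family of finite sets -/
noncomputable def nonmin (Q : Finset (Finset ℕ)) : Finset (Finset ℕ) := by
  classical exact Q.filter (fun x => ∃ z ∈ Q, z ⊂ x)

lemma mem_nonmin {Q : Finset (Finset ℕ)} {x : Finset ℕ} :
    x ∈ nonmin Q ↔ x ∈ Q ∧ ∃ z ∈ Q, z ⊂ x := by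
  simp [nonmin]

lemma nonmin_mono {Q Q' : Finset (Finset ℕ)} (h : Q ⊆ Q') : nonmin Q ⊆ nonmin Q' := by
  intro x hx
  rw [mem_nonmin] at hx ⊢
  exact ⟨h hx.1, hx.2.choose, h hx.2.choose_spec.1, hx.2.choose_spec.2⟩

lemma split_bound (Q : Finset (Finset ℕ)) (hQ : ∅ ∉ Q) (x y : Finset ℕ) (a b : ℕ)
    (hx : x ∈ nonmin Q) (hy : y ∈ nonmin Q) (hxy : x ≠ y)
    (ha : ∀ z ∈ Q, a ∉ z) (hb : ∀ z ∈ Q, b ∉ z) (c : ℕ)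
    (hc : ∀ z ∈ Q, c ∉ z) :
    2 * (nonmin (insert (insert c x) (insert {a} (insert {b} ((Q.erase x).erase y))))).card +
      (insert (insert c x) (insert {a} (insert {b} ((Q.erase x).erase y)))).card
      < 2 * (nonmin Q).card + Q.card := by
  set Q' := (insert {a} (insert {b} ((Q.erase x).erase y))) with hQ'
  have hmem : ∀ z, z ∈ Q' ↔ z = {a} ∨ z = {b} ∨ z ≠ y ∧ z ≠ x ∧ z ∈ Q := by
    intro z
    simp [hQ']
  have hxQ := (mem_nonmin.1 hx).1
  have hyQ := (mem_nonmin.1 hy).1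
  have hempty : ∅ ∉ insert (insert c x) Q' := by
    rw [Finset.mem_insert, hmem]
    rintro (h | h | h | h)
    · exact (Finset.insert_ne_empty _ _).symm h
    · exact (Finset.singleton_ne_empty a).symm h
    · exact (Finset.singleton_ne_empty b).symm h
    · exact hQ h.2.2
  have hsing : ∀ d : ℕ, ∀ z ∈ insert (insert c x) Q', ¬ z ⊂ {d} := by
    intro d z hz hzd
    rw [Finset.ssubset_singleton_iff] at hzd
    exact hempty (hzd ▸ hz)
  have hsub : nonmin (insert (insert c x) Q') ⊆
      insert (insert c x) (((nonmin Q).erase x).erase y) := by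
    intro z hz
    obtain ⟨h1, w, hw, hwz⟩ := mem_nonmin.1 hz
    rw [Finset.mem_insert] at h1 ⊢
    rcases h1 with h1 | h1
    · exact Or.inl h1
    right
    rcases (hmem z).1 h1 with rfl | rfl | ⟨h2, h3, h4⟩
    · exact absurd hwz (hsing _ w hw)
    · exact absurd hwz (hsing _ w hw)
    refine Finset.mem_erase.2 ⟨h2, Finset.mem_erase.2 ⟨h3, mem_nonmin.2 ⟨h4, w, ?_, hwz⟩⟩⟩
    rcases Finset.mem_insert.1 hw with rfl | hw
    · exact absurd (hwz.1 (Finset.mem_insert_self _ _)) (hc z h4)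
    rcases (hmem w).1 hw with rfl | rfl | ⟨_, _, h5⟩
    · exact absurd (hwz.1 (Finset.mem_singleton_self _)) (ha z h4)
    · exact absurd (hwz.1 (Finset.mem_singleton_self _)) (hb z h4)
    · exact h5
  have c1 := Finset.card_le_card hsub
  have c2 := Finset.card_insert_le (insert c x) (((nonmin Q).erase x).erase y)
  have hy' : y ∈ (nonmin Q).erase x := Finset.mem_erase.2 ⟨hxy.symm, hy⟩
  have c3 := Finset.card_erase_add_one hy'
  have c4 := Finset.card_erase_add_one hx
  have c5 := Finset.card_insert_le (insert c x) Q'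
  have c6 := Finset.card_insert_le {a} (insert {b} ((Q.erase x).erase y))
  have c7 := Finset.card_insert_le {b} ((Q.erase x).erase y)
  have hyQ' : y ∈ Q.erase x := Finset.mem_erase.2 ⟨hxy.symm, hyQ⟩
  have c8 := Finset.card_erase_add_one hyQ'
  have c9 := Finset.card_erase_add_one hxQ
  rw [← hQ'] at c6
  omega

theorem Gen.embed (h : Gen X) : ∀ (n : ℕ) (Q : Finset (Finset ℕ)), ∅ ∉ Q →
    2 * (nonmin Q).card + Q.card = n →
    ∃ f : Finset ℕ → X, ∀ a ∈ Q, ∀ b ∈ Q, f a ≤ f b ↔ a ⊆ b := by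
  classical
  intro n
  induction n using Nat.strong_induction_on with
  | _ n ih =>
  intro Q hQ hn
  rcases Q.eq_empty_or_nonempty with rfl | hne
  · exact ⟨fun _ => h.lt.choose, by simp⟩
  have herase : ∀ x ∈ Q, ∃ f : Finset ℕ → X, ∀ a ∈ Q.erase x, ∀ b ∈ Q.erase x,
      f a ≤ f b ↔ a ⊆ b := by
    intro x hx
    refine ih _ ?_ (Q.erase x) (fun hh => hQ (Finset.mem_of_mem_erase hh)) rfl
    have h1 := Finset.card_le_card (nonmin_mono (Finset.erase_subset x Q))
    have h2 := Finset.card_erase_lt_of_mem hx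
    omega
  obtain ⟨x, hx⟩ := Q.exists_maximal hne
  have hxQ := hx.1
  have hxmax : ∀ z ∈ Q, x ⊆ z → z = x := fun z hz hxz => le_antisymm (hx.2 hz hxz) hxz
  by_cases hxmin : x ∈ nonmin Q
  swap
  · -- `x` is isolated
    obtain ⟨f, hf⟩ := herase x hxQ
    obtain ⟨y, hy⟩ := h.isolated ((Q.erase x).image f)
    have hxmin' : ∀ z ∈ Q, z ⊆ x → z = x := by
      intro z hz hzx
      by_contra hne
      exact hxmin (mem_nonmin.2 ⟨hxQ, z, hz, lt_of_le_of_ne hzx hne⟩)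
    refine ⟨Function.update f x y, fun a ha b hb => ?_⟩
    by_cases hax : a = x <;> by_cases hbx : b = x
    · simp [hax, hbx]
    · subst hax
      have hb' := hy _ (Finset.mem_image_of_mem f (Finset.mem_erase.2 ⟨hbx, hb⟩))
      simp only [Function.update_self, Function.update_of_ne hbx]
      exact ⟨fun hh => absurd hh hb'.1, fun hh => absurd (hxmax b hb hh) hbx⟩
    · subst hbx
      have ha' := hy _ (Finset.mem_image_of_mem f (Finset.mem_erase.2 ⟨hax, ha⟩))
      simp only [Function.update_self, Function.update_of_ne hax]
      exact ⟨fun hh => absurd hh ha'.2, fun hh => absurd (hxmin' a ha hh) hax⟩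
    · simp only [Function.update_of_ne hax, Function.update_of_ne hbx]
      exact hf a (Finset.mem_erase.2 ⟨hax, ha⟩) b (Finset.mem_erase.2 ⟨hbx, hb⟩)
  by_cases htop : ∀ z ∈ Q, z ⊆ x
  · -- `x` is the top
    obtain ⟨f, hf⟩ := herase x hxQ
    obtain ⟨y, hy⟩ := h.upper ((Q.erase x).image f)
    refine ⟨Function.update f x y, fun a ha b hb => ?_⟩
    by_cases hax : a = x <;> by_cases hbx : b = x
    · simp [hax, hbx]
    · subst hax
      have hb' := hy _ (Finset.mem_image_of_mem f (Finset.mem_erase.2 ⟨hbx, hb⟩))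
      simp only [Function.update_self, Function.update_of_ne hbx]
      exact ⟨fun hh => absurd hh hb'.not_ge, fun hh => absurd (hxmax b hb hh) hbx⟩
    · subst hbx
      have ha' := hy _ (Finset.mem_image_of_mem f (Finset.mem_erase.2 ⟨hax, ha⟩))
      simp only [Function.update_self, Function.update_of_ne hax]
      exact ⟨fun _ => htop a ha, fun _ => ha'.le⟩
    · simp only [Function.update_of_ne hax, Function.update_of_ne hbx]
      exact hf a (Finset.mem_erase.2 ⟨hax, ha⟩) b (Finset.mem_erase.2 ⟨hbx, hb⟩)
  push Not at htop
  obtain ⟨z, hz, hzx⟩ := htop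
  obtain ⟨y, hzy, hy⟩ := Q.exists_le_maximal hz
  have hyQ := hy.1
  have hymax : ∀ z ∈ Q, y ⊆ z → z = y := fun z hz hxz => le_antisymm (hy.2 hz hxz) hxz
  have hxy : x ≠ y := by rintro rfl; exact hzx hzy
  by_cases hymin : y ∈ nonmin Q
  swap
  · -- `y` is isolated
    obtain ⟨f, hf⟩ := herase y hyQ
    obtain ⟨w, hw⟩ := h.isolated ((Q.erase y).image f)
    have hymin' : ∀ z ∈ Q, z ⊆ y → z = y := by
      intro z hz hzx
      by_contra hne
      exact hymin (mem_nonmin.2 ⟨hyQ, z, hz, lt_of_le_of_ne hzx hne⟩)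
    refine ⟨Function.update f y w, fun a ha b hb => ?_⟩
    by_cases hax : a = y <;> by_cases hbx : b = y
    · simp [hax, hbx]
    · subst hax
      have hb' := hw _ (Finset.mem_image_of_mem f (Finset.mem_erase.2 ⟨hbx, hb⟩))
      simp only [Function.update_self, Function.update_of_ne hbx]
      exact ⟨fun hh => absurd hh hb'.1, fun hh => absurd (hymax b hb hh) hbx⟩
    · subst hbx
      have ha' := hw _ (Finset.mem_image_of_mem f (Finset.mem_erase.2 ⟨hax, ha⟩))
      simp only [Function.update_self, Function.update_of_ne hax]
      exact ⟨fun hh => absurd hh ha'.2, fun hh => absurd (hymin' a ha hh) hax⟩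
    · simp only [Function.update_of_ne hax, Function.update_of_ne hbx]
      exact hf a (Finset.mem_erase.2 ⟨hax, ha⟩) b (Finset.mem_erase.2 ⟨hbx, hb⟩)
  -- two maximal non-minimal elements
  obtain ⟨a, ha⟩ := Infinite.exists_notMem_finset (Q.biUnion id)
  obtain ⟨b, hb⟩ := Infinite.exists_notMem_finset (insert a (Q.biUnion id))
  have hba : b ≠ a := by rintro rfl; exact hb (Finset.mem_insert_self _ _)
  have ha : ∀ z ∈ Q, a ∉ z := fun z hz haz => ha (Finset.mem_biUnion.2 ⟨z, hz, haz⟩)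
  have hb : ∀ z ∈ Q, b ∉ z := fun z hz haz =>
    hb (Finset.mem_insert_of_mem (Finset.mem_biUnion.2 ⟨z, hz, haz⟩))
  set B : Finset (Finset ℕ) := (insert {a} (insert {b} ((Q.erase x).erase y))) with hB
  have hB' : ∅ ∉ B := by
    simp only [hB, Finset.mem_insert, Finset.mem_erase, not_or, not_and]
    exact ⟨(Finset.singleton_ne_empty a).symm, (Finset.singleton_ne_empty b).symm,
      fun _ _ => hQ⟩
  obtain ⟨f1, hf1⟩ := ih _ (hn ▸ split_bound Q hQ x y a b hxmin hymin hxy ha hb a ha)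
    (insert (insert a x) B) (by
      rw [Finset.mem_insert, not_or]
      exact ⟨(Finset.insert_ne_empty _ _).symm, hB'⟩) rfl
  obtain ⟨f2, hf2⟩ := ih _ (hn ▸ split_bound Q hQ y x a b hymin hxmin hxy.symm ha hb b hb)
    (insert (insert b y) B) (by
      rw [Finset.mem_insert, not_or]
      exact ⟨(Finset.insert_ne_empty _ _).symm, hB'⟩) (by
      rw [hB, Finset.erase_right_comm])
  obtain ⟨g, hg⟩ := h.hom B (fun z => f2 z) (fun z => f1 z) (by
    intro z w
    rw [hf1 _ (Finset.mem_insert_of_mem z.2) _ (Finset.mem_insert_of_mem w.2),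
      hf2 _ (Finset.mem_insert_of_mem z.2) _ (Finset.mem_insert_of_mem w.2)])
  have hg : ∀ z ∈ B, g (f2 z) = f1 z := fun z hz => hg ⟨z, hz⟩
  have haB : {a} ∈ B := by simp [hB]
  have hbB : {b} ∈ B := by simp [hB]
  have hQB : ∀ z ∈ Q, z ≠ x → z ≠ y → z ∈ B := by
    intro z hz h1 h2
    simp [hB, hz, h1, h2]
  have hax := ha x hxQ
  have hby := hb y hyQ
  have iI : ∀ {w : Finset ℕ} {Q' : Finset (Finset ℕ)}, w ∈ insert w Q' :=
    fun {w Q'} => Finset.mem_insert_self w Q'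
  have P1 : ∀ z ∈ B, z ∈ Q → (f1 z ≤ f1 (insert a x) ↔ z ⊆ x) := by
    intro z hz hzQ
    rw [hf1 _ (Finset.mem_insert_of_mem hz) _ iI, Finset.subset_insert_iff_of_notMem (ha z hzQ)]
  have P2 : ∀ z ∈ B, z ∈ Q → ¬ f1 (insert a x) ≤ f1 z := by
    intro z hz hzQ hh
    rw [hf1 _ iI _ (Finset.mem_insert_of_mem hz)] at hh
    exact ha z hzQ (hh (Finset.mem_insert_self _ _))
  have P3 : ∀ z ∈ B, z ∈ Q → (f1 z ≤ g (f2 (insert b y)) ↔ z ⊆ y) := by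
    intro z hz hzQ
    rw [← hg z hz, g.le_iff_le, hf2 _ (Finset.mem_insert_of_mem hz) _ iI,
      Finset.subset_insert_iff_of_notMem (hb z hzQ)]
  have P4 : ∀ z ∈ B, z ∈ Q → ¬ g (f2 (insert b y)) ≤ f1 z := by
    intro z hz hzQ hh
    rw [← hg z hz, g.le_iff_le, hf2 _ iI _ (Finset.mem_insert_of_mem hz)] at hh
    exact hb z hzQ (hh (Finset.mem_insert_self _ _))
  have P5 : ¬ f1 (insert a x) ≤ g (f2 (insert b y)) := by
    intro hh
    have h1 : f1 {a} ≤ f1 (insert a x) :=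
      (hf1 _ (Finset.mem_insert_of_mem haB) _ iI).2 (by simp)
    have h2 := h1.trans hh
    rw [← hg _ haB, g.le_iff_le, hf2 _ (Finset.mem_insert_of_mem haB) _ iI] at h2
    have h3 := h2 (Finset.mem_singleton_self a)
    rcases Finset.mem_insert.1 h3 with h3 | h3
    · exact hba h3.symm
    · exact ha y hyQ h3
  have P6 : ¬ g (f2 (insert b y)) ≤ f1 (insert a x) := by
    intro hh
    have h1 : f2 {b} ≤ f2 (insert b y) :=
      (hf2 _ (Finset.mem_insert_of_mem hbB) _ iI).2 (by simp)
    have h2 := (g.le_iff_le.2 h1).trans hh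
    rw [hg _ hbB, hf1 _ (Finset.mem_insert_of_mem hbB) _ iI] at h2
    have h3 := h2 (Finset.mem_singleton_self b)
    rcases Finset.mem_insert.1 h3 with h3 | h3
    · exact hba h3
    · exact hb x hxQ h3
  refine ⟨Function.update (Function.update f1 y (g (f2 (insert b y)))) x (f1 (insert a x)),
    fun z hz w hw => ?_⟩
  have hux : ∀ F : Finset ℕ → X, ∀ v, Function.update F x v x = v := fun F v =>
    Function.update_self _ _ _
  by_cases hzx : z = x
  · subst hzx
    by_cases hwx : w = z
    · simp [hwx]
    by_cases hwy : w = y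
    · subst hwy
      simp only [Function.update_self, Function.update_of_ne hwx]
      exact ⟨fun hh => absurd hh P5, fun hh => absurd (hxmax _ hw hh) hwx⟩
    · simp only [Function.update_self, Function.update_of_ne hwx, Function.update_of_ne hwy]
      exact ⟨fun hh => absurd hh (P2 w (hQB w hw hwx hwy) hw),
        fun hh => absurd (hxmax _ hw hh) hwx⟩
  by_cases hzy : z = y
  · subst hzy
    by_cases hwx : w = x
    · subst hwx
      simp only [Function.update_self, Function.update_of_ne hzx]
      exact ⟨fun hh => absurd hh P6, fun hh => absurd (hymax _ hw hh) hxy⟩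
    by_cases hwy : w = z
    · simp [hwy]
    · simp only [Function.update_self, Function.update_of_ne hwx, Function.update_of_ne hwy,
        Function.update_of_ne hzx]
      exact ⟨fun hh => absurd hh (P4 w (hQB w hw hwx hwy) hw),
        fun hh => absurd (hymax _ hw hh) hwy⟩
  have hzB := hQB z hz hzx hzy
  by_cases hwx : w = x
  · subst hwx
    simp only [Function.update_self, Function.update_of_ne hzx, Function.update_of_ne hzy]
    exact P1 z hzB hz
  by_cases hwy : w = y
  · subst hwy
    simp only [Function.update_self, Function.update_of_ne hzx, Function.update_of_ne hzy,
      Function.update_of_ne hwx]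
    exact P3 z hzB hz
  simp only [Function.update_of_ne hzx, Function.update_of_ne hzy,
      Function.update_of_ne hwx, Function.update_of_ne hwy]
  exact hf1 _ (Finset.mem_insert_of_mem hzB) _ (Finset.mem_insert_of_mem (hQB w hw hwx hwy))

end generic

section ext

/-- The extension property of a subset of a poset. -/
def Ext {X : Type} [PartialOrder X] (A : Set X) : Prop :=
  ∀ L U I J : Finset X, (∀ l ∈ L, l ∈ A) → (∀ u ∈ U, u ∈ A) → (∀ i ∈ I, i ∈ A) →
    (∀ j ∈ J, j ∈ A) → (∀ l ∈ L, ∀ u ∈ U, l < u) → (∀ i ∈ I, ∀ l ∈ L, ¬ i ≤ l) →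
    (∀ j ∈ J, ∀ u ∈ U, ¬ u ≤ j) →
    ∃ y ∈ A, (∀ l ∈ L, l < y) ∧ (∀ u ∈ U, y < u) ∧ (∀ i ∈ I, ¬ i ≤ y) ∧ (∀ j ∈ J, ¬ y ≤ j)

theorem Gen.ext {X : Type} [PartialOrder X] [Countable X] (h : Gen X) : Ext (univ : Set X) := by
  classical
  intro L U I J _ _ _ _ hLU hIL hJU
  obtain ⟨c, hc⟩ := exists_injective_nat (Option X)
  let c' : Option X ↪ ℕ := ⟨c, hc⟩
  set F : Finset X := L ∪ U ∪ I ∪ J with hF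
  let S : X → Finset ℕ := fun z =>
    ((Finset.insertNone F).filter (fun o => o.elim (∃ u ∈ U, u ≤ z) (fun w => w ≤ z))).map c'
  let Y : Finset ℕ :=
    ((Finset.insertNone F).filter (fun o => o.elim True (fun w => ∃ l ∈ L, w ≤ l))).map c'
  have hS : ∀ z ∈ F, ∀ w ∈ F, S z ⊆ S w ↔ z ≤ w := by
    intro z hz w hw
    simp only [S, Finset.map_subset_map]
    constructor
    · intro hh
      have := @hh (some z) (by simp [hz])
      simpa using (Finset.mem_filter.1 this).2
    · intro hzw
      rw [Finset.subset_iff]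
      intro o
      cases o with
      | none =>
        intro ho
        obtain ⟨h1, u, hu, huz⟩ := Finset.mem_filter.1 ho
        exact Finset.mem_filter.2 ⟨h1, u, hu, huz.trans hzw⟩
      | some v =>
        intro ho
        obtain ⟨h1, h2⟩ := Finset.mem_filter.1 ho
        exact Finset.mem_filter.2 ⟨h1, h2.trans hzw⟩
  have hSY : ∀ z ∈ F, S z ⊆ Y ↔ ∃ l ∈ L, z ≤ l := by
    intro z hz
    simp only [S, Y, Finset.map_subset_map]
    constructor
    · intro hh
      have := @hh (some z) (by simp [hz])
      simpa using (Finset.mem_filter.1 this).2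
    · rintro ⟨l, hl, hzl⟩
      rw [Finset.subset_iff]
      intro o
      cases o with
      | none =>
        intro ho
        obtain ⟨h1, _⟩ := Finset.mem_filter.1 ho
        exact Finset.mem_filter.2 ⟨h1, trivial⟩
      | some v =>
        intro ho
        obtain ⟨h1, h2⟩ := Finset.mem_filter.1 ho
        exact Finset.mem_filter.2 ⟨h1, l, hl, h2.trans hzl⟩
  have hYS : ∀ z ∈ F, Y ⊆ S z ↔ ∃ u ∈ U, u ≤ z := by
    intro z hz
    simp only [S, Y, Finset.map_subset_map]
    constructor
    · intro hh
      have := @hh none (by simp)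
      simpa using (Finset.mem_filter.1 this).2
    · rintro ⟨u, hu, hzu⟩
      rw [Finset.subset_iff]
      intro o
      cases o with
      | none =>
        intro ho
        obtain ⟨h1, _⟩ := Finset.mem_filter.1 ho
        exact Finset.mem_filter.2 ⟨h1, u, hu, hzu⟩
      | some v =>
        intro ho
        obtain ⟨h1, l, hl, h2⟩ := Finset.mem_filter.1 ho
        exact Finset.mem_filter.2 ⟨h1, h2.trans ((hLU l hl u hu).le.trans hzu)⟩
  obtain ⟨f, hf⟩ := h.embed _ (insert Y (F.image S)) (by
    rw [Finset.mem_insert, Finset.mem_image]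
    rintro (h0 | ⟨z, hz, h0⟩)
    · have : c' none ∈ Y := by simp [Y]
      rw [← h0] at this
      simp at this
    · have : c' (some z) ∈ S z := by simp [S, hz]
      rw [h0] at this
      simp at this) rfl
  have hmS : ∀ z ∈ F, S z ∈ insert Y (F.image S) := fun z hz =>
    Finset.mem_insert_of_mem (Finset.mem_image_of_mem S hz)
  have hmY : Y ∈ insert Y (F.image S) := Finset.mem_insert_self _ _
  obtain ⟨g, hg⟩ := h.hom F (fun z => f (S z)) (fun z => z) (by
    intro z w
    rw [hf _ (hmS _ z.2) _ (hmS _ w.2), hS _ z.2 _ w.2])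
  have h1 : ∀ z ∈ F, z ≤ g (f Y) ↔ ∃ l ∈ L, z ≤ l := by
    intro z hz
    have := hg ⟨z, hz⟩
    simp only at this
    have e : z ≤ g (f Y) ↔ g (f (S z)) ≤ g (f Y) := by rw [this]
    rw [e, g.le_iff_le, hf _ (hmS _ hz) _ hmY, hSY z hz]
  have h2 : ∀ z ∈ F, g (f Y) ≤ z ↔ ∃ u ∈ U, u ≤ z := by
    intro z hz
    have := hg ⟨z, hz⟩
    simp only at this
    have e : g (f Y) ≤ z ↔ g (f Y) ≤ g (f (S z)) := by rw [this]
    rw [e, g.le_iff_le, hf _ hmY _ (hmS _ hz), hYS z hz]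
  refine ⟨g (f Y), mem_univ _, fun l hl => ?_, fun u hu => ?_, fun i hi => ?_, fun j hj => ?_⟩
  · have hlF : l ∈ F := by simp [hF, hl]
    rw [lt_iff_le_not_ge, h1 l hlF, h2 l hlF]
    refine ⟨⟨l, hl, le_rfl⟩, ?_⟩
    rintro ⟨u, hu, hul⟩
    exact (hLU l hl u hu).not_ge hul
  · have hlF : u ∈ F := by simp [hF, hu]
    rw [lt_iff_le_not_ge, h1 u hlF, h2 u hlF]
    refine ⟨⟨u, hu, le_rfl⟩, ?_⟩
    rintro ⟨l, hl, hul⟩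
    exact (hLU l hl u hu).not_ge hul
  · rw [h1 i (by simp [hF, hi])]
    rintro ⟨l, hl, hil⟩
    exact hIL i hi l hl hil
  · rw [h2 j (by simp [hF, hj])]
    rintro ⟨u, hu, hil⟩
    exact hJU j hj u hu hil

/-- finite partial isomorphisms -/
def PIso (α β : Type) [PartialOrder α] [PartialOrder β] : Type :=
  {f : Finset (α × β) // ∀ p ∈ f, ∀ q ∈ f, p.1 ≤ q.1 ↔ p.2 ≤ q.2}

instance (α β : Type) [PartialOrder α] [PartialOrder β] : Preorder (PIso α β) :=
  inferInstanceAs (Preorder {f : Finset (α × β) // ∀ p ∈ f, ∀ q ∈ f, p.1 ≤ q.1 ↔ p.2 ≤ q.2})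

variable {α β : Type} [PartialOrder α] [PartialOrder β]

lemma across (hβ : Ext (univ : Set β)) (f : Finset (α × β))
    (hf : ∀ p ∈ f, ∀ q ∈ f, p.1 ≤ q.1 ↔ p.2 ≤ q.2) (a : α) :
    ∃ b, ∀ p ∈ f, (p.1 ≤ a ↔ p.2 ≤ b) ∧ (a ≤ p.1 ↔ b ≤ p.2) := by
  classical
  by_cases ha : ∃ p ∈ f, p.1 = a
  · obtain ⟨p, hp, rfl⟩ := ha
    exact ⟨p.2, fun q hq => ⟨hf q hq p hp, hf p hp q hq⟩⟩
  push Not at ha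
  have hlt : ∀ p ∈ f, ∀ q ∈ f, p.1 < q.1 ↔ p.2 < q.2 := fun p hp q hq => by
    rw [lt_iff_le_not_ge, lt_iff_le_not_ge, hf p hp q hq, hf q hq p hp]
  obtain ⟨b, -, h1, h2, h3, h4⟩ := hβ ((f.filter (fun p => p.1 < a)).image Prod.snd)
    ((f.filter (fun p => a < p.1)).image Prod.snd)
    ((f.filter (fun p => ¬ p.1 ≤ a)).image Prod.snd)
    ((f.filter (fun p => ¬ a ≤ p.1)).image Prod.snd)
    (fun _ _ => mem_univ _) (fun _ _ => mem_univ _) (fun _ _ => mem_univ _)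
    (fun _ _ => mem_univ _) (by
      simp only [Finset.forall_mem_image, Finset.mem_filter]
      intro p hp q hq
      exact (hlt p hp.1 q hq.1).1 (hp.2.trans hq.2)) (by
      simp only [Finset.forall_mem_image, Finset.mem_filter]
      intro p hp q hq hh
      exact hp.2 (((hf p hp.1 q hq.1).2 hh).trans hq.2.le)) (by
      simp only [Finset.forall_mem_image, Finset.mem_filter]
      intro p hp q hq hh
      exact hp.2 (hq.2.le.trans ((hf q hq.1 p hp.1).2 hh)))
  simp only [Finset.forall_mem_image, Finset.mem_filter] at h1 h2 h3 h4
  refine ⟨b, fun p hp => ⟨⟨fun hh => ?_, fun hh => ?_⟩, ⟨fun hh => ?_, fun hh => ?_⟩⟩⟩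
  · exact (h1 ⟨hp, lt_of_le_of_ne hh (ha p hp)⟩).le
  · by_contra hn
    exact h3 ⟨hp, hn⟩ hh
  · exact (h2 ⟨hp, lt_of_le_of_ne hh (ha p hp).symm⟩).le
  · by_contra hn
    exact h4 ⟨hp, hn⟩ hh

/-- partial isomorphisms defined at `a` -/
def atLeft (hβ : Ext (univ : Set β)) (a : α) : Order.Cofinal (PIso α β) where
  carrier := {f | ∃ b, (a, b) ∈ f.val}
  isCofinal f := by
    classical
    obtain ⟨b, hb⟩ := across hβ f.val f.prop a
    refine ⟨⟨insert (a, b) f.val, fun p hp q hq => ?_⟩, ⟨b, Finset.mem_insert_self _ _⟩,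
      Finset.subset_insert _ _⟩
    rw [Finset.mem_insert] at hp hq
    rcases hp with rfl | hp <;> rcases hq with rfl | hq
    · simp
    · exact (hb q hq).2
    · exact (hb p hp).1
    · exact f.prop p hp q hq

/-- partial isomorphisms whose range contains `b` -/
def atRight (hα : Ext (univ : Set α)) (b : β) : Order.Cofinal (PIso α β) where
  carrier := {f | ∃ a, (a, b) ∈ f.val}
  isCofinal f := by
    classical
    obtain ⟨a, ha⟩ := across hα (f.val.image Prod.swap) (by
      simp only [Finset.forall_mem_image]
      intro p hp q hq
      exact (f.prop p hp q hq).symm) b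
    simp only [Finset.forall_mem_image] at ha
    refine ⟨⟨insert (a, b) f.val, fun p hp q hq => ?_⟩, ⟨a, Finset.mem_insert_self _ _⟩,
      Finset.subset_insert _ _⟩
    rw [Finset.mem_insert] at hp hq
    rcases hp with rfl | hp <;> rcases hq with rfl | hq
    · simp
    · exact (ha hq).2.symm
    · exact (ha hp).1.symm
    · exact f.prop p hp q hq

theorem back_forth [Countable α] [Countable β] (hα : Ext (univ : Set α))
    (hβ : Ext (univ : Set β)) : Nonempty (α ≃o β) := by
  cases nonempty_encodable α
  cases nonempty_encodable β
  let co : α ⊕ β → Order.Cofinal (PIso α β) := fun p => Sum.elim (atLeft hβ) (atRight hα) p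
  let d : PIso α β := ⟨∅, by simp⟩
  let I : Order.Ideal (PIso α β) := Order.idealOfCofinals d co
  have hF : ∀ a, ∃ b, ∃ f ∈ I, (a, b) ∈ f.val := by
    intro a
    obtain ⟨f, ⟨b, hb⟩, hf⟩ := Order.cofinal_meets_idealOfCofinals d co (Sum.inl a)
    exact ⟨b, f, hf, hb⟩
  have hG : ∀ b, ∃ a, ∃ f ∈ I, (a, b) ∈ f.val := by
    intro b
    obtain ⟨f, ⟨a, ha⟩, hf⟩ := Order.cofinal_meets_idealOfCofinals d co (Sum.inr b)
    exact ⟨a, f, hf, ha⟩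
  have key : ∀ a b a' b', (∃ f ∈ I, (a, b) ∈ f.val) → (∃ f ∈ I, (a', b') ∈ f.val) →
      (a ≤ a' ↔ b ≤ b') := by
    rintro a b a' b' ⟨f, hf, hab⟩ ⟨g, hg, hab'⟩
    obtain ⟨m, _, fm, gm⟩ := I.directed _ hf _ hg
    exact m.prop (a, b) (fm hab) (a', b') (gm hab')
  choose F hF using hF
  choose G hG using hG
  refine ⟨⟨⟨F, G, fun a => ?_, fun b => ?_⟩, fun {a a'} => (key _ _ _ _ (hF a) (hF a')).symm⟩⟩
  · exact le_antisymm ((key _ _ _ _ (hG (F a)) (hF a)).2 le_rfl)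
      ((key _ _ _ _ (hF a) (hG (F a))).2 le_rfl)
  · exact le_antisymm ((key _ _ _ _ (hF (G b)) (hG b)).1 le_rfl)
      ((key _ _ _ _ (hG b) (hF (G b))).1 le_rfl)

end ext

section D
variable {X : Type} [PartialOrder X]

lemma Ext.sub {A : Set X} (h : Ext A) : Ext (univ : Set A) := by
  classical
  intro L U I J _ _ _ _ h1 h2 h3
  obtain ⟨y, hy, k1, k2, k3, k4⟩ := h (L.image (↑)) (U.image (↑)) (I.image (↑)) (J.image (↑))
    (by simp only [Finset.forall_mem_image]; exact fun x _ => x.2)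
    (by simp only [Finset.forall_mem_image]; exact fun x _ => x.2)
    (by simp only [Finset.forall_mem_image]; exact fun x _ => x.2)
    (by simp only [Finset.forall_mem_image]; exact fun x _ => x.2)
    (by simp only [Finset.forall_mem_image]; exact fun l hl u hu => h1 l hl u hu)
    (by simp only [Finset.forall_mem_image]; exact fun l hl u hu => h2 l hl u hu)
    (by simp only [Finset.forall_mem_image]; exact fun l hl u hu => h3 l hl u hu)
  simp only [Finset.forall_mem_image] at k1 k2 k3 k4
  exact ⟨⟨y, hy⟩, mem_univ _, fun l hl => k1 hl, fun l hl => k2 hl, fun l hl => k3 hl,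
    fun l hl => k4 hl⟩

lemma Ext.copy [Countable X] (hX : Ext (univ : Set X)) {A : Set X} (h : Ext A) : IsCopyO A :=
  back_forth h.sub hX

/-- The set of realizations of a quantifier free type. -/
def W (L U I J : Finset X) : Set X :=
  {y | (∀ l ∈ L, l < y) ∧ (∀ u ∈ U, y < u) ∧ (∀ i ∈ I, ¬ i ≤ y) ∧ (∀ j ∈ J, ¬ y ≤ j)}

lemma Ext.W (hX : Ext (univ : Set X)) (L U I J : Finset X) (h1 : ∀ l ∈ L, ∀ u ∈ U, l < u)
    (h2 : ∀ i ∈ I, ∀ l ∈ L, ¬ i ≤ l) (h3 : ∀ j ∈ J, ∀ u ∈ U, ¬ u ≤ j) : Ext (W L U I J) := by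
  classical
  intro L' U' I' J' hL hU hI hJ k1 k2 k3
  obtain ⟨y, -, m1, m2, m3, m4⟩ := hX (L ∪ L') (U ∪ U') (I ∪ I') (J ∪ J')
    (fun _ _ => mem_univ _) (fun _ _ => mem_univ _) (fun _ _ => mem_univ _)
    (fun _ _ => mem_univ _) (by
      intro l hl u hu
      rcases Finset.mem_union.1 hl with hl | hl <;> rcases Finset.mem_union.1 hu with hu | hu
      · exact h1 l hl u hu
      · exact (hU u hu).1 l hl
      · exact (hL l hl).2.1 u hu
      · exact k1 l hl u hu) (by
      intro i hi l hl
      rcases Finset.mem_union.1 hl with hl | hl <;> rcases Finset.mem_union.1 hi with hi | hi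
      · exact h2 i hi l hl
      · exact ((hI i hi).1 l hl).not_ge
      · exact (hL l hl).2.2.1 i hi
      · exact k2 i hi l hl) (by
      intro i hi l hl
      rcases Finset.mem_union.1 hl with hl | hl <;> rcases Finset.mem_union.1 hi with hi | hi
      · exact h3 i hi l hl
      · exact ((hJ i hi).2.1 l hl).not_ge
      · exact (hU l hl).2.2.2 i hi
      · exact k3 i hi l hl)
  simp only [Finset.mem_union, or_imp, forall_and] at m1 m2 m3 m4
  exact ⟨y, ⟨m1.1, m2.1, m3.1, m4.1⟩, m1.2, m2.2, m3.2, m4.2⟩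

lemma indiv [Countable X] (hX : Ext (univ : Set X)) (P : Set X) :
    IsCopyO P ∨ ∃ C, IsCopyO C ∧ C ⊆ Pᶜ := by
  by_cases hP : Ext P
  · exact Or.inl (hX.copy hP)
  right
  unfold Ext at hP
  push Not at hP
  obtain ⟨L, U, I, J, -, -, -, -, h1, h2, h3, h4⟩ := hP
  refine ⟨W L U I J, hX.copy (hX.W L U I J h1 h2 h3), fun y hy hyP => ?_⟩
  obtain ⟨j, hj, hj'⟩ := h4 y hyP hy.1 hy.2.1 hy.2.2.1
  exact hy.2.2.2 j hj hj'

lemma indiv_finite [Countable X] (hX : Ext (univ : Set X)) {ι : Type} (s : Finset ι) :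
    ∀ (P : ι → Set X) (f : X → X), OE f → (∀ x, ∃ i ∈ s, f x ∈ P i) →
    ∃ i ∈ s, ∃ g : X → X, OE g ∧ ∀ x, f (g x) ∈ P i := by
  classical
  induction s using Finset.induction_on with
  | empty =>
    intro P f hf h
    obtain ⟨y, -⟩ := hX ∅ ∅ ∅ ∅ (by simp) (by simp) (by simp) (by simp) (by simp) (by simp)
      (by simp)
    simpa using h y
  | insert a s _ ih =>
    intro P f hf h
    rcases indiv hX (f ⁻¹' P a) with hc | ⟨C, hC, hCP⟩
    · obtain ⟨g, hg, hr⟩ := copy_emb hc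
      refine ⟨a, Finset.mem_insert_self _ _, g, hg, fun x => ?_⟩
      have : g x ∈ range g := mem_range_self x
      rw [hr] at this
      exact this
    · obtain ⟨g, hg, hr⟩ := copy_emb hC
      have hgP : ∀ x, f (g x) ∉ P a := by
        intro x
        have : g x ∈ range g := mem_range_self x
        rw [hr] at this
        exact hCP this
      obtain ⟨i, hi, k, hk, hki⟩ := ih P (f ∘ g) (hf.comp hg) (by
        intro x
        obtain ⟨i, hi, hx⟩ := h (g x)
        rcases Finset.mem_insert.1 hi with rfl | hi
        · exact absurd hx (hgP x)
        · exact ⟨i, hi, hx⟩)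
      exact ⟨i, Finset.mem_insert_of_mem hi, g ∘ k, hg.comp hk, hki⟩

theorem caseD [Countable X] [Infinite X] (h : Gen X) :
    ∃ 𝒜 : Set (Set X), 𝒜.Countable ∧ 𝒜.Infinite ∧ IsMaxAntichainO 𝒜 := by
  classical
  have hX := h.ext
  obtain ⟨e, he⟩ := exists_injective_nat X
  have hfin : ∀ n, {w : X | e w < n}.Finite := fun n => (finite_Iio n).preimage he.injOn
  let A : X → Set X := fun v => {x | v < x ∧ ∀ w, e w < e v → ¬ w ≤ x}
  let M : Set X := {v | ∀ w, e w < e v → ¬ w ≤ v}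
  have least : ∀ x, ∃ v ∈ M, v ≤ x ∧ (∀ w, e w < e v → ¬ w ≤ x) := by
    intro x
    have hP : ∃ n, ∃ v, v ≤ x ∧ e v = n := ⟨_, x, le_rfl, rfl⟩
    obtain ⟨v, hv, hvn⟩ := Nat.find_spec hP
    have hmin : ∀ w, e w < e v → ¬ w ≤ x := by
      intro w hw hwx
      rw [hvn] at hw
      exact Nat.find_min hP hw ⟨w, hwx, rfl⟩
    exact ⟨v, fun w hw hwv => hmin w hw (hwv.trans hv), hv, hmin⟩
  have hMinf : M.Infinite := by
    intro hM
    obtain ⟨x, hx⟩ := h.lower hM.toFinset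
    obtain ⟨v, hv, hvx, -⟩ := least x
    exact (hx v (hM.mem_toFinset.2 hv)).not_ge hvx
  have : Infinite M := hMinf.to_subtype
  refine mk_antichain (ι := M) (fun v => A v) ?_ ?_ ?_
  · rintro ⟨v, hv⟩
    have : A v = W {v} ∅ (hfin (e v)).toFinset ∅ := by
      ext x
      simp [A, W]
    simp only [this]
    apply hX.copy
    apply hX.W
    · simp
    · intro i hi l hl
      rw [Finset.mem_singleton.1 hl]
      exact hv i (by simpa using hi)
    · simp
  · rintro ⟨v, hv⟩ ⟨w, hw⟩ hne hc
    obtain ⟨f, hf, hfA⟩ := compat_iff.1 hc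
    have hx := hfA v
    rcases lt_trichotomy (e v) (e w) with hlt | heq | hlt
    · exact hx.2.2 v hlt hx.1.1.le
    · exact hne (Subtype.ext (he heq))
    · exact hx.1.2 w hlt hx.2.1.le
  · intro Z hZ
    obtain ⟨f, hf, rfl⟩ := copy_emb hZ
    obtain ⟨x0⟩ : Nonempty X := inferInstance
    obtain ⟨g, hg, hgr⟩ := copy_emb (hX.copy (hX.W {x0} ∅ ∅ ∅ (by simp) (by simp) (by simp)))
    have hgx : ∀ x, f x0 ≤ f (g x) := by
      intro x
      have : g x ∈ range g := mem_range_self x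
      rw [hgr] at this
      exact (hf _ _).2 (this.1 x0 (Finset.mem_singleton_self _)).le
    obtain ⟨v, hv, k, hk, hkv⟩ := indiv_finite hX (hfin (e (f x0) + 1)).toFinset
      (fun v => {x | v ∈ M ∧ v ≤ x ∧ (∀ w, e w < e v → ¬ w ≤ x)}) (f ∘ g) (hf.comp hg) (by
        intro x
        obtain ⟨v, hv1, hv2, hv3⟩ := least (f (g x))
        refine ⟨v, ?_, hv1, hv2, hv3⟩
        simp only [Finite.mem_toFinset]
        by_contra hn
        exact hv3 (f x0) (by simp at hn; omega) (hgx x))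
    obtain ⟨i, -, k', hk', hkk⟩ := indiv_finite hX (Finset.univ : Finset Bool)
      (fun b => if b then A v else {v}) (f ∘ g ∘ k) (hf.comp (hg.comp hk)) (by
        intro x
        obtain ⟨_, h2, h3⟩ := hkv x
        rcases h2.eq_or_lt with h2 | h2
        · exact ⟨false, Finset.mem_univ _, by simpa using h2.symm⟩
        · exact ⟨true, Finset.mem_univ _, by simpa using ⟨h2, h3⟩⟩)
    have hoe : OE (f ∘ g ∘ k ∘ k') := hf.comp (hg.comp (hk.comp hk'))
    cases i with
    | false =>
      exfalso
      obtain ⟨a, b, hab⟩ := h.lt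
      have h1 : (f ∘ g ∘ k ∘ k') a = v := by simpa using hkk a
      have h2 : (f ∘ g ∘ k ∘ k') b = v := by simpa using hkk b
      exact hab.ne (hoe.inj (h1.trans h2.symm))
    | true =>
      exact ⟨⟨v, (hkv x0).1⟩, compat_iff.2 ⟨_, hoe, fun x =>
        ⟨mem_range_self _, by simpa using hkk x⟩⟩⟩

end D

end UHP

theorem uh_poset_countable_max_antichain_iff (X : Type) [PartialOrder X]
    [Countable X] [Infinite X] (hX : UltrahomogeneousOrder X) :
    (∃ 𝒜 : Set (Set X), 𝒜.Countable ∧ 𝒜.Infinite ∧ IsMaxAntichainO 𝒜) ↔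
      (¬ (∀ x y : X, x ≠ y → ¬ x < y ∧ ¬ y < x) ∧
       ¬ Nonempty (((· < ·) : X → X → Prop) ≃r Bw)) := by
  classical
  constructor
  · intro h𝒜
    constructor
    · intro hanti
      obtain ⟨d⟩ := nonempty_denumerable X
      let Φ : X ≃ ℕ × Unit := (Denumerable.eqv X).trans (Equiv.prodPUnit ℕ).symm
      refine UHP.no_countable Φ (fun x y => ?_) h𝒜
      constructor
      · intro hxy
        rcases hxy.eq_or_lt with rfl | hlt
        · simp
        · exact absurd hlt (hanti x y hlt.ne).1
      · rintro ⟨h1, -⟩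
        exact (Φ.injective (Prod.ext h1 rfl)).le
    · rintro ⟨e⟩
      refine UHP.no_countable e.toEquiv (fun x y => ?_) h𝒜
      have hlt : x < y ↔ (e x).1 = (e y).1 ∧ (e x).2 < (e y).2 := (e.map_rel_iff (a := x) (b := y)).symm
      change x ≤ y ↔ (e x).1 = (e y).1 ∧ (e x).2 ≤ (e y).2
      rw [le_iff_lt_or_eq, hlt]
      constructor
      · rintro (h | rfl)
        · exact ⟨h.1, h.2.le⟩
        · simp
      · rintro ⟨h1, h2⟩
        rcases h2.eq_or_lt with h2 | h2
        · exact Or.inr (e.injective (Prod.ext h1 h2))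
        · exact Or.inl ⟨h1, h2⟩
  · rintro ⟨hna, hnB⟩
    have hH := UHP.hom_of_uh hX
    have hlt : ∃ x y : X, x < y := by
      by_contra hn
      push Not at hn
      exact hna fun x y _ => ⟨hn x y, hn y x⟩
    by_cases h12 : ∃ a b c : X, a < b ∧ UHP.Inc c a ∧ UHP.Inc c b
    · by_cases hVL : (∃ a b c : X, a < c ∧ b < c ∧ UHP.Inc a b) ∨
          (∃ a b c : X, c < a ∧ c < b ∧ UHP.Inc a b)
      · exact UHP.caseD (UHP.gen_of' hH h12 hVL)
      · rw [not_or] at hVL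
        exact UHP.structB hH hlt (fun a b c h1 h2 h3 => hVL.2 ⟨b, c, a, h1, h2, h3⟩)
          (fun a b c h1 h2 h3 => hVL.1 ⟨b, c, a, h1, h2, h3⟩) hnB
    · exact UHP.structC hH hlt (fun a b c h1 h2 h3 => h12 ⟨a, b, c, h1, h2, h3⟩)
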